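/- Let f : ℝ^d → ℝ be convex and twice continuously differentiable, and suppose ∇²f(x) ⪯ L·I for all x ∈ B(x₀, M), where x₀ ∈ ℝ^d, 0 < L < ∞ and M > 0. If λ > ‖∇f(x₀)‖₂, then for every x ∈ B( x₀, min{ (λ − ‖∇f(x₀)‖₂)/L, M } ), one has inf_{y∈ℝ^d} { f(y) + λ‖x − y‖₂ } = f(x), and y = x is the unique minimizer of y ↦ f(y) + λ‖x − y‖₂. -/

import Mathlib

open Metric

/-- The quadratic form of the Hessian of `f` at `θ`, evaluated at `v`. -/
noncomputable def hessQ {d : ℕ} (f : EuclideanSpace ℝ (Fin d) → ℝ)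
    (θ v : EuclideanSpace ℝ (Fin d)) : ℝ :=
  iteratedFDeriv ℝ 2 f θ ![v, v]


section helpers
variable {d : ℕ} {f : EuclideanSpace ℝ (Fin d) → ℝ}

lemma aux_line (x v : EuclideanSpace ℝ (Fin d)) (t : ℝ) :
    HasDerivAt (fun s : ℝ => x + s • v) v t := by
  simpa using ((hasDerivAt_id t).smul_const v).const_add x

lemma aux_grad (hconv : ConvexOn ℝ Set.univ f) (hC2 : ContDiff ℝ 2 f)
    (x y : EuclideanSpace ℝ (Fin d)) : f x + fderiv ℝ f x (y - x) ≤ f y := by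
  have hdf : Differentiable ℝ f := hC2.differentiable (by norm_num)
  have h1 : ConvexOn ℝ Set.univ (fun t : ℝ => f (x + t • (y - x))) := by
    have := hconv.comp_affineMap (AffineMap.lineMap x y : ℝ →ᵃ[ℝ] EuclideanSpace ℝ (Fin d))
    simp only [Set.preimage_univ] at this
    have he : (fun t : ℝ => f (x + t • (y - x))) = f ∘ (AffineMap.lineMap x y) := by
      funext t
      simp [AffineMap.lineMap_apply, add_comm]
    rw [he]
    exact this
  have h2 : HasDerivAt (fun t : ℝ => f (x + t • (y - x))) (fderiv ℝ f x (y - x)) 0 := by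
    have := (hdf (x + (0:ℝ) • (y - x))).hasFDerivAt.comp_hasDerivAt (0:ℝ) (aux_line x (y - x) 0)
    simpa [Function.comp_def] using this
  have h3 := h1.le_slope_of_hasDerivAt (Set.mem_univ 0) (Set.mem_univ 1) one_pos h2
  simp [slope_def_field] at h3
  have h4 : fderiv ℝ f x (y - x) = fderiv ℝ f x y - fderiv ℝ f x x := map_sub _ _ _
  linarith

lemma aux_hasDeriv (hC2 : ContDiff ℝ 2 f) (x v w : EuclideanSpace ℝ (Fin d)) (t : ℝ) :
    HasDerivAt (fun s : ℝ => fderiv ℝ f (x + s • v) w)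
      (fderiv ℝ (fderiv ℝ f) (x + t • v) v w) t := by
  have hd : Differentiable ℝ (fderiv ℝ f) :=
    (hC2.fderiv_right (m := 1) (by norm_num)).differentiable (by norm_num)
  have := (hd (x + t • v)).hasFDerivAt.comp_hasDerivAt t (aux_line x v t)
  simpa using this.clm_apply (hasDerivAt_const t w)

lemma aux_psd (hconv : ConvexOn ℝ Set.univ f) (hC2 : ContDiff ℝ 2 f)
    (x v : EuclideanSpace ℝ (Fin d)) : 0 ≤ fderiv ℝ (fderiv ℝ f) x v v := by
  have hm : Monotone (fun s : ℝ => fderiv ℝ f (x + s • v) v) := by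
    intro s t hst
    rcases hst.eq_or_lt with rfl | hst
    · rfl
    have h1 := aux_grad hconv hC2 (x + s • v) (x + t • v)
    have h2 := aux_grad hconv hC2 (x + t • v) (x + s • v)
    rw [show x + t • v - (x + s • v) = (t - s) • v by module, map_smul, smul_eq_mul] at h1
    rw [show x + s • v - (x + t • v) = (s - t) • v by module, map_smul, smul_eq_mul] at h2
    have h3 : 0 < t - s := sub_pos.2 hst
    change fderiv ℝ f (x + s • v) v ≤ fderiv ℝ f (x + t • v) v
    nlinarith
  have := hm.deriv_nonneg (x := 0)
  rw [(aux_hasDeriv hC2 x v v 0).deriv] at this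
  simpa using this

lemma aux_bilin (hconv : ConvexOn ℝ Set.univ f) (hC2 : ContDiff ℝ 2 f)
    (x : EuclideanSpace ℝ (Fin d)) (L : ℝ) (h : ∀ v, hessQ f x v ≤ L * ‖v‖ ^ 2)
    (w e : EuclideanSpace ℝ (Fin d)) (he : ‖e‖ = 1) :
    fderiv ℝ (fderiv ℝ f) x w e ≤ L / 2 * (‖w‖ + inner ℝ w e) := by
  by_cases hw : w = 0
  · simp [hw]
  have hr : 0 < ‖w‖ := norm_pos_iff.2 hw
  have hs : fderiv ℝ (fderiv ℝ f) x e w = fderiv ℝ (fderiv ℝ f) x w e :=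
    (hC2.contDiffAt.isSymmSndFDerivAt (by simp)) e w
  have h1 := h (w + ‖w‖ • e)
  have h2 := aux_psd hconv hC2 x (w - ‖w‖ • e)
  have h3 : ‖w + ‖w‖ • e‖ ^ 2 = 2 * ‖w‖ * (‖w‖ + inner ℝ w e) := by
    rw [norm_add_sq_real, norm_smul, inner_smul_right, he]
    simp; ring
  rw [h3, hessQ, iteratedFDeriv_two_apply] at h1
  simp only [Matrix.cons_val_zero, Matrix.cons_val_one, map_add, map_smul, map_sub,
    ContinuousLinearMap.add_apply, ContinuousLinearMap.sub_apply, ContinuousLinearMap.smul_apply,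
    smul_eq_mul, hs] at h1 h2
  have h4 : ‖w‖ * fderiv ℝ (fderiv ℝ f) x w e ≤ ‖w‖ * (L / 2 * (‖w‖ + inner ℝ w e)) := by
    linarith
  exact le_of_mul_le_mul_left h4 hr

lemma aux_bound (hconv : ConvexOn ℝ Set.univ f) (hC2 : ContDiff ℝ 2 f)
    (x₀ : EuclideanSpace ℝ (Fin d)) (L M : ℝ)
    (hhess : ∀ x ∈ closedBall x₀ M, ∀ v, hessQ f x v ≤ L * ‖v‖ ^ 2)
    (w e : EuclideanSpace ℝ (Fin d)) (he : ‖e‖ = 1) (hw : ‖w‖ ≤ M) :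
    fderiv ℝ f (x₀ + w) e ≤ ‖gradient f x₀‖ + L / 2 * (‖w‖ + inner ℝ w e) := by
  have h1 := (convex_Icc (0:ℝ) 1).image_sub_le_mul_sub_of_deriv_le
    (f := fun s : ℝ => fderiv ℝ f (x₀ + s • w) e) (C := L / 2 * (‖w‖ + inner ℝ w e))
    (fun t _ => (aux_hasDeriv hC2 x₀ w e t).continuousAt.continuousWithinAt)
    (fun t _ => (aux_hasDeriv hC2 x₀ w e t).differentiableAt.differentiableWithinAt)
    (fun t ht => by
      rw [(aux_hasDeriv hC2 x₀ w e t).deriv]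
      have ht' := interior_subset ht
      refine aux_bilin hconv hC2 _ L (hhess _ ?_) w e he
      rw [mem_closedBall, dist_eq_norm, add_sub_cancel_left, norm_smul, Real.norm_eq_abs,
        abs_of_nonneg ht'.1]
      nlinarith [ht'.2, norm_nonneg w])
    0 (by simp) 1 (by simp) zero_le_one
  have h2 : fderiv ℝ f x₀ e ≤ ‖gradient f x₀‖ := by
    have : ‖gradient f x₀‖ = ‖fderiv ℝ f x₀‖ := by simp [gradient]
    rw [this]
    have h3 := (fderiv ℝ f x₀).le_opNorm e
    rw [he, mul_one] at h3
    exact (le_abs_self _).trans h3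
  simp only [one_smul, zero_smul, add_zero, sub_zero, mul_one] at h1
  linarith

end helpers

/-- Infimal convolution with a steep enough norm penalty leaves a smooth convex function
unchanged near a point of small gradient, and the infimum there is uniquely attained
at `y = x`. -/
theorem stmt_18 {d : ℕ} (hd : 1 ≤ d) (f : EuclideanSpace ℝ (Fin d) → ℝ)
    (hconv : ConvexOn ℝ Set.univ f) (hC2 : ContDiff ℝ 2 f)
    (x₀ : EuclideanSpace ℝ (Fin d)) (L M : ℝ) (hL : 0 < L) (hM : 0 < M)
    (hhess : ∀ x ∈ closedBall x₀ M, ∀ v, hessQ f x v ≤ L * ‖v‖ ^ 2)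
    (lam : ℝ) (hlam : ‖gradient f x₀‖ < lam) :
    ∀ x ∈ closedBall x₀ (min ((lam - ‖gradient f x₀‖) / L) M),
      IsLeast (Set.range fun y => f y + lam * ‖x - y‖) (f x) ∧
      ∀ y, f y + lam * ‖x - y‖ = f x → y = x := by
  intro x hx
  rw [mem_closedBall, dist_eq_norm, le_min_iff, le_div_iff₀ hL] at hx
  obtain ⟨hx1, hx2⟩ := hx
  have key : ∀ y, y ≠ x → f x < f y + lam * ‖x - y‖ := by
    intro y hy
    have hp : 0 < ‖x - y‖ := norm_pos_iff.2 (sub_ne_zero.2 hy.symm)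
    obtain ⟨e, he, hye⟩ : ∃ e : EuclideanSpace ℝ (Fin d), ‖e‖ = 1 ∧ x - y = ‖x - y‖ • e := by
      refine ⟨‖x - y‖⁻¹ • (x - y), ?_, ?_⟩
      · rw [norm_smul, norm_inv, norm_norm, inv_mul_cancel₀ hp.ne']
      · rw [smul_smul, mul_inv_cancel₀ hp.ne', one_smul]
    set p := ‖x - y‖ with hpdef
    obtain ⟨w, rfl⟩ : ∃ w, x = x₀ + w := ⟨x - x₀, by simp⟩
    rw [add_sub_cancel_left] at hx1 hx2
    have hy' : y = x₀ + w - p • e := by rw [← hye]; abel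
    have hb := aux_bound hconv hC2 x₀ L M hhess w e he hx2
    have hin : inner ℝ w e ≤ ‖w‖ := by
      have := real_inner_le_norm w e
      rwa [he, mul_one] at this
    -- the gradient inequality along `e`
    have hg : ∀ z (a : ℝ), f z - a * fderiv ℝ f z e ≤ f (z - a • e) := by
      intro z a
      have := aux_grad hconv hC2 z (z - a • e)
      rw [show z - a • e - z = (-a) • e by module, map_smul, smul_eq_mul] at this
      linarith
    have hle : fderiv ℝ f (x₀ + w) e ≤ lam := by nlinarith
    rcases hle.lt_or_eq with hlt | heq
    · have := hg (x₀ + w) p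
      rw [← hy'] at this
      nlinarith
    · have hin2 : inner ℝ w e = ‖w‖ := by nlinarith
      have hr : 0 < ‖w‖ := by
        by_contra hcon
        have : ‖w‖ = 0 := le_antisymm (not_lt.1 hcon) (norm_nonneg _)
        rw [hin2, this] at hb
        linarith
      have hwe : w = ‖w‖ • e := by
        have := (inner_eq_norm_mul_iff_real (x := w) (y := e)).1 (by rw [hin2, he, mul_one])
        rw [he, one_smul] at this
        exact this
      obtain ⟨s, hs0, hsp, hsr⟩ : ∃ s : ℝ, 0 < s ∧ s < p ∧ s ≤ ‖w‖ :=
        ⟨min (p / 2) ‖w‖, lt_min (by linarith) hr,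
          (min_le_left _ _).trans_lt (by linarith), min_le_right _ _⟩
      have hwn : ‖(‖w‖ - s) • e‖ = ‖w‖ - s := by
        rw [norm_smul, he, mul_one, Real.norm_eq_abs, abs_of_nonneg (by linarith)]
      have hb2 := aux_bound hconv hC2 x₀ L M hhess ((‖w‖ - s) • e) e he
        (by rw [hwn]; linarith)
      rw [hwn, inner_smul_left, real_inner_self_eq_norm_sq, he] at hb2
      have hz : x₀ + (‖w‖ - s) • e = x₀ + w - s • e := by
        rw [sub_smul, ← hwe]; abel
      rw [hz] at hb2
      simp only [RCLike.conj_to_real, one_pow, mul_one] at hb2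
      have hlt : fderiv ℝ f (x₀ + w - s • e) e < lam := by nlinarith
      have g1 := hg (x₀ + w) s
      have g2 := hg (x₀ + w - s • e) (p - s)
      rw [show x₀ + w - s • e - (p - s) • e = x₀ + w - p • e by module, ← hy'] at g2
      rw [heq] at g1
      nlinarith
  refine ⟨⟨⟨x, by simp⟩, ?_⟩, ?_⟩
  · rintro _ ⟨y, rfl⟩
    by_cases hy : y = x
    · simp [hy]
    · exact (key y hy).le
  · intro y hy
    by_contra hne
    exact absurd hy (key y hne).ne'
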